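/- Fix two distinct points p₁, p₂ ∈ ℙ²(ℂ), and let W denote the projective space of plane quartics that are singular at both p₁ and p₂. The set of irreducible quartics X whose only singularities are ordinary nodes at p₁ and p₂ and for which there exists an irreducible quartic Y ≠ X, whose only singularities are ordinary nodes at p₁ and p₂, having the same set of theta-lines as X, is contained in a proper Zariski-closed subset of W. In other words, a general binodal quartic is uniquely determined, among binodal quartics with the same two nodes, by its theta-lines. -/

import Mathlib

open MvPolynomial

noncomputable section

abbrev P2 : Type := Projectivization ℂ (Fin 3 → ℂ)

/-- The zero locus in `ℙ²` of a polynomial `F`: the points all of whose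
representative vectors are zeros of `F`. -/
def curve (F : MvPolynomial (Fin 3) ℂ) : Set P2 :=
  {p | ∀ (w : Fin 3 → ℂ) (hw : w ≠ 0), Projectivization.mk ℂ w hw = p → eval w F = 0}

/-- The projective line spanned by two vectors. -/
def lineThrough (u v : Fin 3 → ℂ) : Set P2 :=
  {p | ∃ s t : ℂ, ∃ h : s • u + t • v ≠ 0, p = Projectivization.mk ℂ (s • u + t • v) h}

/-- A subset of `ℙ²` is a line if it is the projective span of two
linearly independent vectors. -/
def IsLine (S : Set P2) : Prop :=
  ∃ u v : Fin 3 → ℂ, LinearIndependent ℂ ![u, v] ∧ S = lineThrough u v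

/-- The restriction of `F` to the affine parametrization `t ↦ a + t • b` of the line
through `[a]` and `[b]`, as a polynomial in `t`. -/
def lineRest (F : MvPolynomial (Fin 3) ℂ) (a b : Fin 3 → ℂ) : Polynomial ℂ :=
  eval₂ Polynomial.C (fun i => Polynomial.C (a i) + Polynomial.X * Polynomial.C (b i)) F

/-- The local intersection multiplicity, at the point `[a]`, of the curve `F = 0` with the
line through `[a]` and `[b]` (parametrized by `t ↦ a + t • b`, the point `[a]`
corresponding to `t = 0`). -/
def multAt (F : MvPolynomial (Fin 3) ℂ) (a b : Fin 3 → ℂ) : ℕ :=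
  Polynomial.rootMultiplicity 0 (lineRest F a b)

/-- The scheme `X ∩ L` (for `X = {F = 0}`, `L` a line) is everywhere nonreduced: at each
point of `X ∩ L` the local intersection multiplicity is at least `2`.  (Stated over all
parametrizations of `L`; the base point `a` of a parametrization is a point of `L`, and
every point of `L` occurs as such a base point.) -/
def EverywhereTangent (F : MvPolynomial (Fin 3) ℂ) (S : Set P2) : Prop :=
  ∀ a b : Fin 3 → ℂ, LinearIndependent ℂ ![a, b] → S = lineThrough a b →
    ∀ ha : a ≠ 0, Projectivization.mk ℂ a ha ∈ curve F → 2 ≤ multAt F a b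

/-- A theta-line of the quartic `F`: either contained in the curve, or intersecting it
everywhere nonreducedly. -/
def ThetaLine (F : MvPolynomial (Fin 3) ℂ) (S : Set P2) : Prop :=
  IsLine S ∧ (S ⊆ curve F ∨ EverywhereTangent F S)

/-- A bitangent line of (a smooth curve) `F = 0`: a line, not contained in the curve,
whose scheme-theoretic intersection with the curve is everywhere nonreduced. -/
def Bitangent (F : MvPolynomial (Fin 3) ℂ) (S : Set P2) : Prop :=
  IsLine S ∧ ¬ S ⊆ curve F ∧ EverywhereTangent F S

/-- The line `S` is tangent to the curve `F = 0` at the point `q`: the local intersection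
multiplicity there is at least `2`. -/
def TangentAt (F : MvPolynomial (Fin 3) ℂ) (S : Set P2) (q : P2) : Prop :=
  IsLine S ∧ q ∈ S ∧ q ∈ curve F ∧
    ∀ a b : Fin 3 → ℂ, LinearIndependent ℂ ![a, b] → S = lineThrough a b →
      ∀ ha : a ≠ 0, Projectivization.mk ℂ a ha = q → 2 ≤ multAt F a b

/-- The curve `F = 0` is smooth: `F` and its partial derivatives have no common
projective zero. -/
def SmoothCurve (F : MvPolynomial (Fin 3) ℂ) : Prop :=
  ∀ w : Fin 3 → ℂ, w ≠ 0 → ¬ (eval w F = 0 ∧ ∀ i : Fin 3, eval w (pderiv i F) = 0)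

/-- Iterated partial derivative along a list of coordinate directions. -/
def pderivList (l : List (Fin 3)) (F : MvPolynomial (Fin 3) ℂ) : MvPolynomial (Fin 3) ℂ :=
  l.foldr (fun i G => pderiv i G) F

/-- `F` vanishes to order at least `m` at the point `p` (all partial derivatives of
order `< m` vanish at `p`); i.e. `p` is a point of multiplicity at least `m` of `F = 0`. -/
def VanishesToOrder (F : MvPolynomial (Fin 3) ℂ) (p : P2) (m : ℕ) : Prop :=
  ∀ l : List (Fin 3), l.length < m →
    ∀ (w : Fin 3 → ℂ) (hw : w ≠ 0), Projectivization.mk ℂ w hw = p →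
      eval w (pderivList l F) = 0

/-- `p` is a singular point of the curve `F = 0`. -/
def IsSingularAt (F : MvPolynomial (Fin 3) ℂ) (p : P2) : Prop :=
  VanishesToOrder F p 2

/-- `p` is a double point: a point of multiplicity exactly `2`. -/
def IsDoublePoint (F : MvPolynomial (Fin 3) ℂ) (p : P2) : Prop :=
  VanishesToOrder F p 2 ∧ ¬ VanishesToOrder F p 3

/-- The quadratic form (in the direction `b`) cutting out the tangent cone of `F = 0`
at the double point `[a]`: the degree-`2` Taylor coefficient of `t ↦ F (a + t • b)`. -/
def coneCoeff (F : MvPolynomial (Fin 3) ℂ) (a b : Fin 3 → ℂ) : ℂ :=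
  (lineRest F a b).coeff 2

/-- `p` is an ordinary node: a double point whose tangent cone consists of two distinct
lines, i.e. the tangent-cone quadratic has two null directions independent modulo `a`. -/
def OrdinaryNode (F : MvPolynomial (Fin 3) ℂ) (p : P2) : Prop :=
  IsDoublePoint F p ∧
    ∀ (a : Fin 3 → ℂ) (ha : a ≠ 0), Projectivization.mk ℂ a ha = p →
      ∃ b₁ b₂ : Fin 3 → ℂ, LinearIndependent ℂ ![a, b₁, b₂] ∧
        coneCoeff F a b₁ = 0 ∧ coneCoeff F a b₂ = 0

/-- At the double point `[a]`, the tangent cone is the double line through `[a]` and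
`[b₀]`: `b₀` is a null direction of the tangent-cone quadratic, and every null
direction lies on the line spanned by `a` and `b₀`. -/
def DoubleLineCone (F : MvPolynomial (Fin 3) ℂ) (a b₀ : Fin 3 → ℂ) : Prop :=
  LinearIndependent ℂ ![a, b₀] ∧ coneCoeff F a b₀ = 0 ∧
    ∀ b : Fin 3 → ℂ, coneCoeff F a b = 0 → b ∈ Submodule.span ℂ ({a, b₀} : Set (Fin 3 → ℂ))

/-- `p` is an ordinary cusp: a double point whose tangent cone is a double line `L₀`
with local intersection multiplicity `i(L₀ · X) = 3` at `p`. -/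
def OrdinaryCusp (F : MvPolynomial (Fin 3) ℂ) (p : P2) : Prop :=
  IsDoublePoint F p ∧
    ∀ (a : Fin 3 → ℂ) (ha : a ≠ 0), Projectivization.mk ℂ a ha = p →
      ∃ b₀ : Fin 3 → ℂ, DoubleLineCone F a b₀ ∧ multAt F a b₀ = 3

/-- `p` is an ordinary tacnode: a double point whose tangent cone is a double line `L₀`
with local intersection multiplicity `i(L₀ · X) = 4` at `p`. -/
def OrdinaryTacnode (F : MvPolynomial (Fin 3) ℂ) (p : P2) : Prop :=
  IsDoublePoint F p ∧
    ∀ (a : Fin 3 → ℂ) (ha : a ≠ 0), Projectivization.mk ℂ a ha = p →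
      ∃ b₀ : Fin 3 → ℂ, DoubleLineCone F a b₀ ∧ multAt F a b₀ = 4

/-- A theta-line of type `i`: a theta-line, not a component of the curve, containing
exactly `i` singular points of the curve. -/
def ThetaLineOfType (F : MvPolynomial (Fin 3) ℂ) (i : ℕ) (S : Set P2) : Prop :=
  ThetaLine F S ∧ ¬ S ⊆ curve F ∧ {p | p ∈ S ∧ IsSingularAt F p}.ncard = i

/-- Three points of `ℙ²` are collinear. -/
def Collin (p q r : P2) : Prop :=
  ∃ S : Set P2, IsLine S ∧ p ∈ S ∧ q ∈ S ∧ r ∈ S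


/-- An ordinary bitangent: a bitangent meeting the curve at exactly two distinct points,
each with local intersection multiplicity exactly `2`. -/
def OrdinaryBitangent (F : MvPolynomial (Fin 3) ℂ) (S : Set P2) : Prop :=
  Bitangent F S ∧ (S ∩ curve F).ncard = 2 ∧
    ∀ a b : Fin 3 → ℂ, LinearIndependent ℂ ![a, b] → S = lineThrough a b →
      ∀ ha : a ≠ 0, Projectivization.mk ℂ a ha ∈ curve F → multAt F a b = 2

/-- A bitangent meeting the curve only at smooth points. -/
def SmoothBitangent (F : MvPolynomial (Fin 3) ℂ) (S : Set P2) : Prop :=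
  Bitangent F S ∧ ∀ p ∈ S ∩ curve F, ¬ IsSingularAt F p

/-- The octic whose roots are the slopes of the theta-lines avoiding the nodes of the binodal
quartic `u²v² + l u²z² + 2 m uvz² + k v²z² + 2 p uz³ + 2 q vz³ + r z⁴`. -/
def thetaOctic {K : Type*} [CommRing K] (l m k p q r : K) : Polynomial K :=
  Polynomial.C (-k ^ 4) * Polynomial.X ^ 8 + Polynomial.C (-4 * k ^ 3 * m) * Polynomial.X ^ 7 +
  Polynomial.C (4 * k ^ 2 * (r - m ^ 2)) * Polynomial.X ^ 6 +
  Polynomial.C (4 * k ^ 2 * l * m + 16 * k * p * q) * Polynomial.X ^ 5 +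
  Polynomial.C (2 * k ^ 2 * l ^ 2 + 8 * k * l * (m ^ 2 - r) + 16 * (k * p ^ 2 + l * q ^ 2)) *
    Polynomial.X ^ 4 +
  Polynomial.C (4 * k * l ^ 2 * m + 16 * l * p * q) * Polynomial.X ^ 3 +
  Polynomial.C (4 * l ^ 2 * (r - m ^ 2)) * Polynomial.X ^ 2 +
  Polynomial.C (-4 * l ^ 3 * m) * Polynomial.X + Polynomial.C (-l ^ 4)

lemma thetaOctic_map {K K' : Type*} [CommRing K] [CommRing K'] (φ : K →+* K') (l m k p q r : K) :
    (thetaOctic l m k p q r).map φ = thetaOctic (φ l) (φ m) (φ k) (φ p) (φ q) (φ r) := by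
  simp [thetaOctic, map_ofNat φ]

lemma thetaOctic_eval {K : Type*} [CommRing K] (l m k p q r s : K) :
    (thetaOctic l m k p q r).eval s =
      16 * s ^ 3 * (p + q * s) * (k * p * s + l * q) +
        (4 * r * s ^ 2 - (l + 2 * m * s + k * s ^ 2) ^ 2) * (k * s ^ 2 - l) ^ 2 := by
  simp only [thetaOctic, Polynomial.eval_add, Polynomial.eval_mul, Polynomial.eval_C,
    Polynomial.eval_pow, Polynomial.eval_X]
  ring

lemma thetaOctic_natDegree {K : Type*} [Field K] (l m k p q r : K) (hk : k ≠ 0) :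
    (thetaOctic l m k p q r).natDegree = 8 := by
  unfold thetaOctic
  compute_degree!

lemma thetaOctic_coeff_one (l m k p q r : ℂ) : (thetaOctic l m k p q r).coeff 1 =
    -4 * l ^ 3 * m := by
  simp [thetaOctic, Polynomial.coeff_C, -map_mul, -map_pow, -map_neg, -map_sub, -map_add]

lemma thetaOctic_coeff_two (l m k p q r : ℂ) : (thetaOctic l m k p q r).coeff 2 =
    4 * l ^ 2 * (r - m ^ 2) := by
  simp [thetaOctic, -map_mul, -map_pow, -map_neg, -map_sub, -map_add]

lemma thetaOctic_coeff_three (l m k p q r : ℂ) : (thetaOctic l m k p q r).coeff 3 =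
    4 * k * l ^ 2 * m + 16 * l * p * q := by
  simp [thetaOctic, -map_mul, -map_pow, -map_neg, -map_sub, -map_add]

lemma thetaOctic_coeff_four (l m k p q r : ℂ) : (thetaOctic l m k p q r).coeff 4 =
    2 * k ^ 2 * l ^ 2 + 8 * k * l * (m ^ 2 - r) + 16 * (k * p ^ 2 + l * q ^ 2) := by
  simp [thetaOctic, -map_mul, -map_pow, -map_neg, -map_sub, -map_add]

/-- With `y = s x + h z` and `x, y` centred coordinates, the restriction of the binodal quartic
is the square of `s x² + h xz + f z²`. -/
def SquareOnLine (l m k p q r s h : ℂ) : Prop :=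
  ∃ f : ℂ, 2 * s * f = l + 2 * m * s + k * s ^ 2 ∧ (m + k * s) * h + p + q * s = h * f ∧
    k * h ^ 2 + 2 * q * h + r = f ^ 2

lemma SquareOnLine.cubic {l m k p q r s h : ℂ} (H : SquareOnLine l m k p q r s h) :
    h * (k * s ^ 2 - l) = -2 * s * (p + q * s) := by
  obtain ⟨f, h1, h2, -⟩ := H
  linear_combination 2 * s * h2 + h * h1

lemma SquareOnLine.isRoot {l m k p q r s h : ℂ} (H : SquareOnLine l m k p q r s h) :
    (thetaOctic l m k p q r).eval s = 0 := by
  have h0 := H.cubic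
  obtain ⟨f, h1, -, h3⟩ := H
  rw [thetaOctic_eval]
  have e : 4 * s ^ 2 * (k * h ^ 2 + 2 * q * h + r) = (l + 2 * m * s + k * s ^ 2) ^ 2 := by
    rw [h3, ← h1]; ring
  have e2 : (h * (k * s ^ 2 - l)) ^ 2 = (-2 * s * (p + q * s)) ^ 2 := by rw [h0]
  linear_combination (k * s ^ 2 - l) ^ 2 * e - 4 * s ^ 2 * k * e2 -
    8 * s ^ 2 * q * (k * s ^ 2 - l) * h0

lemma squareOnLine_of_isRoot {l m k p q r s : ℂ} (hs : s ≠ 0) (hq : k * s ^ 2 - l ≠ 0)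
    (H : (thetaOctic l m k p q r).eval s = 0) :
    SquareOnLine l m k p q r s (-2 * s * (p + q * s) / (k * s ^ 2 - l)) := by
  obtain ⟨h, hh⟩ : ∃ h, h = -2 * s * (p + q * s) / (k * s ^ 2 - l) := ⟨_, rfl⟩
  rw [← hh]
  have h0 : h * (k * s ^ 2 - l) = -2 * s * (p + q * s) := by
    rw [hh, div_mul_cancel₀ _ hq]
  obtain ⟨f, hf⟩ : ∃ f, f = (l + 2 * m * s + k * s ^ 2) / (2 * s) := ⟨_, rfl⟩
  have h1 : 2 * s * f = l + 2 * m * s + k * s ^ 2 := by rw [hf]; field_simp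
  rw [thetaOctic_eval] at H
  refine ⟨f, h1, ?_, ?_⟩
  · apply mul_left_cancel₀ (mul_ne_zero two_ne_zero hs)
    linear_combination h0 - h * h1
  · apply mul_left_cancel₀ (mul_ne_zero (pow_ne_zero 2 (mul_ne_zero two_ne_zero hs))
      (pow_ne_zero 2 hq))
    have e2 : (h * (k * s ^ 2 - l)) ^ 2 = (-2 * s * (p + q * s)) ^ 2 := by rw [h0]
    have e3 : (2 * s * f) ^ 2 = (l + 2 * m * s + k * s ^ 2) ^ 2 := by rw [h1]
    linear_combination H - (k * s ^ 2 - l) ^ 2 * e3 + 4 * s ^ 2 * k * e2 +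
      8 * s ^ 2 * q * (k * s ^ 2 - l) * h0

lemma thetaOctic_root_ne_zero {l m k p q r s : ℂ} (hl : l ≠ 0)
    (H : (thetaOctic l m k p q r).eval s = 0) : s ≠ 0 := by
  rintro rfl
  rw [thetaOctic_eval] at H
  apply hl
  simpa using H

lemma thetaOctic_root_quadric_ne_zero {l m k p q r s : ℂ} (hl : l ≠ 0) (hk : k ≠ 0)
    (hpq : p ^ 2 * k - q ^ 2 * l ≠ 0)
    (H : (thetaOctic l m k p q r).eval s = 0) : k * s ^ 2 - l ≠ 0 := by
  intro h
  have hs := thetaOctic_root_ne_zero hl H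
  rw [thetaOctic_eval] at H
  have h1 : 16 * s ^ 4 * k * (p + q * s) ^ 2 = 0 := by
    linear_combination H +
      (16 * s ^ 3 * (p + q * s) * q - (4 * r * s ^ 2 - (l + 2 * m * s + k * s ^ 2) ^ 2) *
        (k * s ^ 2 - l)) * h
  have h2 : p + q * s = 0 := by simpa [hs, hk] using h1
  apply hpq
  linear_combination k * (p - q * s) * h2 + q ^ 2 * h

lemma coeffs_eq_zero_of_forall_sum {n : ℕ} {c : Fin n → ℂ}
    (h : ∀ s : ℂ, ∑ i, c i * s ^ (i : ℕ) = 0) (i : Fin n) : c i = 0 := by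
  have h0 : ∑ i, Polynomial.C (c i) * Polynomial.X ^ (i : ℕ) = 0 := by
    apply Polynomial.funext
    intro s
    simpa [Polynomial.eval_finsetSum] using h s
  have h1 := congrArg (fun P => Polynomial.coeff P i) h0
  simpa [Polynomial.finsetSum_coeff, Polynomial.coeff_X_pow, Fin.val_inj] using h1

lemma params_eq_of_squareOnLine {a b l m k p q r a' b' l' m' k' p' q' r' : ℂ}
    (hl : l ≠ 0) (hk : k ≠ 0) (hpq : p ^ 2 * k - q ^ 2 * l ≠ 0)
    (hsep : (thetaOctic l m k p q r).Separable)
    (H : ∀ s n : ℂ, s ≠ 0 → SquareOnLine l m k p q r s (n + a - b * s) →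
      SquareOnLine l' m' k' p' q' r' s (n + a' - b' * s)) :
    (a' = a ∧ b' = b ∧ l' = l ∧ m' = m ∧ k' = k ∧ p' = p ∧ q' = q ∧ r' = r) ∨
      (l' = 0 ∧ k' = 0 ∧ p' = 0 ∧ q' = 0 ∧ r' = m' ^ 2) := by
  set T : Finset ℂ := (thetaOctic l m k p q r).roots.toFinset with hT
  have hdeg := thetaOctic_natDegree l m k p q r hk
  have hcard : T.card = 8 := by
    rw [hT, Multiset.toFinset_card_of_nodup (Polynomial.nodup_roots hsep), ← hdeg]
    exact (Polynomial.splits_iff_card_roots.mp (IsAlgClosed.splits _))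
  have hroot : ∀ s ∈ T, (thetaOctic l m k p q r).eval s = 0 := by
    intro s hs
    rw [hT, Multiset.mem_toFinset] at hs
    exact (Polynomial.mem_roots'.mp hs).2
  have hS : ∀ s ∈ T, ∃ h : ℂ, s ≠ 0 ∧ SquareOnLine l m k p q r s h ∧
      SquareOnLine l' m' k' p' q' r' s (h + (a' - a) - (b' - b) * s) := by
    intro s hs
    have h0 := hroot s hs
    have hs0 := thetaOctic_root_ne_zero hl h0
    have h1 := squareOnLine_of_isRoot hs0 (thetaOctic_root_quadric_ne_zero hl hk hpq h0) h0
    refine ⟨_, hs0, h1, ?_⟩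
    have h2 := H s ((-2 * s * (p + q * s) / (k * s ^ 2 - l)) - a + b * s) hs0
      (by convert h1 using 1; ring)
    convert h2 using 1
    ring
  have hE : ∀ s : ℂ, (k * s ^ 2 - l) * (k' * s ^ 2 - l') * ((a' - a) - (b' - b) * s) =
      -2 * s * (p' + q' * s) * (k * s ^ 2 - l) + 2 * s * (p + q * s) * (k' * s ^ 2 - l') := by
    let E : Polynomial ℂ := (Polynomial.C k * Polynomial.X ^ 2 - Polynomial.C l) *
      (Polynomial.C k' * Polynomial.X ^ 2 - Polynomial.C l') *
      (Polynomial.C (a' - a) - Polynomial.C (b' - b) * Polynomial.X) -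
      (-2 * Polynomial.X * (Polynomial.C p' + Polynomial.C q' * Polynomial.X) *
        (Polynomial.C k * Polynomial.X ^ 2 - Polynomial.C l) +
      2 * Polynomial.X * (Polynomial.C p + Polynomial.C q * Polynomial.X) *
        (Polynomial.C k' * Polynomial.X ^ 2 - Polynomial.C l'))
    have hev : ∀ s, E.eval s = (k * s ^ 2 - l) * (k' * s ^ 2 - l') *
        ((a' - a) - (b' - b) * s) - (-2 * s * (p' + q' * s) * (k * s ^ 2 - l) +
        2 * s * (p + q * s) * (k' * s ^ 2 - l')) := by
      intro s; simp [E]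
    have hE0 : E = 0 := by
      apply Polynomial.eq_zero_of_natDegree_lt_card_of_eval_eq_zero' _ T
      · intro s hs
        obtain ⟨h, -, h1, h2⟩ := hS s hs
        rw [hev]
        linear_combination (k * s ^ 2 - l) * h2.cubic - (k' * s ^ 2 - l') * h1.cubic
      · rw [hcard]
        apply lt_of_le_of_lt (b := 5) _ (by norm_num)
        simp only [E]
        compute_degree
    intro s
    have := hev s
    rw [hE0] at this
    simp only [Polynomial.eval_zero] at this
    linear_combination -this
  obtain ⟨t, ht⟩ : ∃ t : ℂ, t ^ 2 = l / k := IsAlgClosed.exists_pow_nat_eq _ (by norm_num)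
  have ht' : k * t ^ 2 - l = 0 := by rw [ht]; field_simp; ring
  have ht0 : t ≠ 0 := by
    rintro rfl
    apply hl
    linear_combination -ht'
  have hqt : p + q * t ≠ 0 := by
    intro h
    apply hpq
    linear_combination k * (p - q * t) * h + q ^ 2 * ht'
  have hkl' : k' * t ^ 2 - l' = 0 := by
    have := hE t
    rw [ht'] at this
    have h3 : t * (p + q * t) * (k' * t ^ 2 - l') = 0 := by linear_combination -this / 2
    simpa [ht0, hqt] using h3
  obtain ⟨κ, hκ⟩ : ∃ κ, κ = k' / k := ⟨_, rfl⟩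
  have hk' : k' = κ * k := by rw [hκ]; field_simp
  have hl' : l' = κ * l := by
    linear_combination -hkl' + t ^ 2 * hk' + κ * ht'
  subst hk' hl'
  have hE2 := coeffs_eq_zero_of_forall_sum (c := ![κ * (a' - a) * l ^ 2,
    -(κ * (b' - b) * l + 2 * (p' - κ * p)) * l, -2 * (κ * (a' - a) * k + (q' - κ * q)) * l,
    2 * k * (p' - κ * p) + 2 * κ * (b' - b) * k * l,
    k * (κ * (a' - a) * k + 2 * (q' - κ * q)), -(κ * (b' - b) * k ^ 2)]) (by
      intro s
      simp [Fin.sum_univ_six]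
      linear_combination hE s)
  have ha : κ * (a' - a) = 0 := by simpa [hl] using hE2 0
  have hb : κ * (b' - b) = 0 := by simpa [hk] using hE2 5
  have hp' : p' = κ * p := by
    have h1 := hE2 1
    rw [hb] at h1
    simp [hl] at h1
    linear_combination h1
  have hq' : q' = κ * q := by
    have h1 := hE2 4
    rw [ha] at h1
    simp [hk] at h1
    linear_combination h1
  subst hp' hq'
  by_cases hκ0 : κ = 0
  · right
    subst hκ0
    obtain ⟨s, hs⟩ : T.Nonempty := by rw [← Finset.card_pos, hcard]; norm_num
    obtain ⟨h, hs0, -, f, h1, h2, h3⟩ := hS s hs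
    have : f = m' := by
      apply mul_left_cancel₀ (mul_ne_zero two_ne_zero hs0)
      linear_combination h1
    subst this
    refine ⟨by simp, by simp, by simp, by simp, by linear_combination h3⟩
  left
  have ha' : a' = a := by
    have := (mul_eq_zero.mp ha).resolve_left hκ0
    linear_combination this
  have hb' : b' = b := by
    have := (mul_eq_zero.mp hb).resolve_left hκ0
    linear_combination this
  have hD : thetaOctic (κ * l) m' (κ * k) (κ * p) (κ * q) r' -
      Polynomial.C (κ ^ 4) * thetaOctic l m k p q r = 0 := by
    apply Polynomial.eq_zero_of_natDegree_lt_card_of_eval_eq_zero' _ T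
    · intro s hs
      obtain ⟨h, -, h1, h2⟩ := hS s hs
      simp [h1.isRoot, h2.isRoot]
    · rw [hcard]
      apply lt_of_le_of_lt (b := 7) _ (by norm_num)
      apply Polynomial.natDegree_le_pred (n := 8)
      · unfold thetaOctic
        compute_degree
      · simp [thetaOctic, -map_mul, -map_pow, -map_neg, -map_sub, -map_add]
        ring
  have hc : ∀ i, (thetaOctic (κ * l) m' (κ * k) (κ * p) (κ * q) r').coeff i =
      κ ^ 4 * (thetaOctic l m k p q r).coeff i := by
    intro i
    rw [sub_eq_zero.mp hD, Polynomial.coeff_C_mul]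
  have hm : m' = κ * m := by
    have h1 := hc 1
    rw [thetaOctic_coeff_one, thetaOctic_coeff_one] at h1
    apply mul_left_cancel₀ (mul_ne_zero (pow_ne_zero 3 hκ0) (pow_ne_zero 3 hl))
    linear_combination -h1 / 4
  subst hm
  have hr : r' = κ ^ 2 * r := by
    have h1 := hc 2
    rw [thetaOctic_coeff_two, thetaOctic_coeff_two] at h1
    apply mul_left_cancel₀ (mul_ne_zero (pow_ne_zero 2 hκ0) (pow_ne_zero 2 hl))
    linear_combination h1 / 4
  subst hr
  have hκ1 : κ = 1 := by
    by_contra hne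
    have hne' : κ ^ 3 * (κ - 1) ≠ 0 := mul_ne_zero (pow_ne_zero 3 hκ0) (sub_ne_zero.mpr hne)
    have h3 := hc 3
    have h4 := hc 4
    rw [thetaOctic_coeff_three, thetaOctic_coeff_three] at h3
    rw [thetaOctic_coeff_four, thetaOctic_coeff_four] at h4
    have e3 : l * (p * q) = 0 := by
      apply mul_left_cancel₀ hne'
      linear_combination -h3 / 16
    have e4 : k * p ^ 2 + l * q ^ 2 = 0 := by
      apply mul_left_cancel₀ hne'
      linear_combination -h4 / 16
    apply hpq
    apply pow_eq_zero_iff (two_ne_zero) |>.mp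
    linear_combination (k * p ^ 2 + l * q ^ 2) * e4 - 4 * k * p * q * e3
  subst hκ1
  refine ⟨ha', hb', ?_, ?_, ?_, ?_, ?_, ?_⟩ <;> ring

lemma exists_sq_of_roots_multiple {c₃ c₂ c₁ c₀ : ℂ}
    (H : ∀ x : ℂ, x ^ 4 + c₃ * x ^ 3 + c₂ * x ^ 2 + c₁ * x + c₀ = 0 →
      4 * x ^ 3 + 3 * c₃ * x ^ 2 + 2 * c₂ * x + c₁ = 0) :
    ∃ B C : ℂ, c₃ = 2 * B ∧ c₂ = B ^ 2 + 2 * C ∧ c₁ = 2 * B * C ∧ c₀ = C ^ 2 := by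
  obtain ⟨x₁, hx₁⟩ : ∃ x, (Polynomial.X ^ 4 + Polynomial.C c₃ * Polynomial.X ^ 3 +
      Polynomial.C c₂ * Polynomial.X ^ 2 + Polynomial.C c₁ * Polynomial.X +
      Polynomial.C c₀).IsRoot x := by
    apply IsAlgClosed.exists_root
    have : (Polynomial.X ^ 4 + Polynomial.C c₃ * Polynomial.X ^ 3 +
      Polynomial.C c₂ * Polynomial.X ^ 2 + Polynomial.C c₁ * Polynomial.X +
      Polynomial.C c₀).degree = 4 := by compute_degree!
    rw [this]
    norm_num
  replace hx₁ : x₁ ^ 4 + c₃ * x₁ ^ 3 + c₂ * x₁ ^ 2 + c₁ * x₁ + c₀ = 0 := by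
    simpa using hx₁
  have hx₁' := H x₁ hx₁
  obtain ⟨d, hd⟩ : ∃ d, d = c₃ + 2 * x₁ := ⟨_, rfl⟩
  obtain ⟨e, he⟩ : ∃ e, e = c₂ + 2 * x₁ * d - x₁ ^ 2 := ⟨_, rfl⟩
  obtain ⟨x₂, hx₂⟩ : ∃ x, (Polynomial.X ^ 2 + Polynomial.C d * Polynomial.X +
      Polynomial.C e).IsRoot x := by
    apply IsAlgClosed.exists_root
    have : (Polynomial.X ^ 2 + Polynomial.C d * Polynomial.X +
      Polynomial.C e).degree = 2 := by compute_degree!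
    rw [this]
    norm_num
  replace hx₂ : x₂ ^ 2 + d * x₂ + e = 0 := by simpa using hx₂
  have h3 : c₃ = d - 2 * x₁ := by rw [hd]; ring
  have h2 : c₂ = e - 2 * x₁ * d + x₁ ^ 2 := by rw [he]; ring
  subst h3 h2
  have h1 : c₁ = -2 * x₁ * e + x₁ ^ 2 * d := by linear_combination hx₁'
  subst h1
  have h0 : c₀ = x₁ ^ 2 * e := by linear_combination hx₁
  subst h0
  have hroot : ∀ x, x ^ 2 + d * x + e = 0 → (x - x₁) ^ 2 * (2 * x + d) = 0 := by
    intro x hx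
    have := H x (by linear_combination (x - x₁) ^ 2 * hx)
    linear_combination this - 2 * (x - x₁) * hx
  have hdisc : d ^ 2 = 4 * e := by
    have ha := hroot x₂ hx₂
    have hb := hroot (-d - x₂) (by linear_combination hx₂)
    by_cases h : 2 * x₂ + d = 0
    · linear_combination (2 * x₂ + d) * h - 4 * hx₂
    · have ha' : x₂ - x₁ = 0 := by simpa [h] using ha
      have h' : 2 * (-d - x₂) + d ≠ 0 := fun h' => h (by linear_combination -h')
      have hb' : -d - x₂ - x₁ = 0 := by simpa [h'] using hb
      exact absurd (by linear_combination ha' - hb') h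
  refine ⟨-x₁ + d / 2, -x₁ * d / 2, by ring, ?_, ?_, ?_⟩
  · linear_combination -hdisc / 4
  · linear_combination x₁ * hdisc / 2
  · linear_combination -x₁ ^ 2 * hdisc / 4

lemma eval_lineRest (F : MvPolynomial (Fin 3) ℂ) (a b : Fin 3 → ℂ) (t : ℂ) :
    (lineRest F a b).eval t = eval (a + t • b) F := by
  have h : (Polynomial.evalRingHom t).comp (eval₂Hom Polynomial.C
      (fun i => Polynomial.C (a i) + Polynomial.X * Polynomial.C (b i))) =
      eval (a + t • b) := by
    ext i <;> simp [mul_comm t]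
  exact congrArg (fun φ => φ F) h

lemma coeff_eq_zero_of_two_le_multAt {F : MvPolynomial (Fin 3) ℂ} {a b : Fin 3 → ℂ}
    (h : 2 ≤ multAt F a b) : (lineRest F a b).coeff 1 = 0 := by
  have h1 : Polynomial.X ^ 2 ∣ lineRest F a b := by
    have := (pow_dvd_pow (Polynomial.X - Polynomial.C (0 : ℂ)) h).trans
      (Polynomial.pow_rootMultiplicity_dvd (lineRest F a b) 0)
    simpa using this
  exact Polynomial.X_pow_dvd_iff.mp h1 1 (by norm_num)

lemma exists_eq_of_mk_eq {u v : Fin 3 → ℂ} {hu : u ≠ 0} {hv : v ≠ 0}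
    (h : Projectivization.mk ℂ u hu = Projectivization.mk ℂ v hv) : ∃ c : ℂ, u = c • v := by
  obtain ⟨c, hc⟩ := (Projectivization.mk_eq_mk_iff' ℂ u v hu hv).mp h
  exact ⟨c, hc.symm⟩

lemma exists_eq_of_lineThrough_eq {u v a b : Fin 3 → ℂ} (h : lineThrough u v = lineThrough a b)
    (hab : LinearIndependent ℂ ![a, b]) :
    (∃ α β : ℂ, a = α • u + β • v) ∧ ∃ γ δ : ℂ, b = γ • u + δ • v := by
  have key : ∀ w : Fin 3 → ℂ, w ≠ 0 → (∃ s t : ℂ, w = s • a + t • b) →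
      ∃ α β : ℂ, w = α • u + β • v := by
    rintro w hw ⟨s, t, rfl⟩
    have hm : Projectivization.mk ℂ _ hw ∈ lineThrough a b := ⟨s, t, hw, rfl⟩
    rw [← h] at hm
    obtain ⟨s', t', h', he⟩ := hm
    obtain ⟨c, hc⟩ := exists_eq_of_mk_eq he
    exact ⟨c * s', c * t', by rw [hc, smul_add, smul_smul, smul_smul]⟩
  exact ⟨key a (by simpa using hab.ne_zero 0) ⟨1, 0, by simp⟩,
    key b (by simpa using hab.ne_zero 1) ⟨0, 1, by simp⟩⟩

lemma lineThrough_add_smul (u v : Fin 3 → ℂ) (c : ℂ) :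
    lineThrough u v = lineThrough (c • u + v) u := by
  ext x
  constructor
  · rintro ⟨s, t, h, rfl⟩
    have e : s • u + t • v = t • (c • u + v) + (s - t * c) • u := by module
    exact ⟨t, s - t * c, e ▸ h, by congr 1⟩
  · rintro ⟨s, t, h, rfl⟩
    have e : s • (c • u + v) + t • u = (s * c + t) • u + s • v := by module
    exact ⟨s * c + t, s, e ▸ h, by congr 1⟩

/-- The general quartic form singular at the first two coordinate points with nonzero
coefficient `w` of `x²y²`, written in the centred coordinates `x + b z` and `y + a z`. -/
def binodalForm (w a b l m k p q r x y z : ℂ) : ℂ :=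
  w * ((x + b * z) ^ 2 * (y + a * z) ^ 2 + l * (x + b * z) ^ 2 * z ^ 2 +
    2 * m * (x + b * z) * (y + a * z) * z ^ 2 + k * (y + a * z) ^ 2 * z ^ 2 +
    2 * p * (x + b * z) * z ^ 3 + 2 * q * (y + a * z) * z ^ 3 + r * z ^ 4)

section ThetaLines

variable {e₁ e₂ e₃ : Fin 3 → ℂ} {F : MvPolynomial (Fin 3) ℂ} {w a b l m k p q r : ℂ}

lemma coords_eq_zero (hli : LinearIndependent ℂ ![e₁, e₂, e₃]) {x y z : ℂ}
    (h : x • e₁ + y • e₂ + z • e₃ = 0) : x = 0 ∧ y = 0 ∧ z = 0 := by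
  have := Fintype.linearIndependent_iff.mp hli ![x, y, z] (by simpa [Fin.sum_univ_three] using h)
  exact ⟨this 0, this 1, this 2⟩

lemma linearIndependent_line (hli : LinearIndependent ℂ ![e₁, e₂, e₃]) (s n : ℂ) :
    LinearIndependent ℂ ![e₁ + s • e₂, n • e₂ + e₃] := by
  rw [LinearIndependent.pair_iff]
  intro x z h
  have e : x • e₁ + (x * s + z * n) • e₂ + z • e₃ = 0 := by rw [← h]; module
  obtain ⟨hx, -, hz⟩ := coords_eq_zero hli e
  exact ⟨hx, hz⟩

lemma linearIndependent_add_smul {u v : Fin 3 → ℂ} (h : LinearIndependent ℂ ![u, v]) (c : ℂ) :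
    LinearIndependent ℂ ![c • u + v, u] := by
  rw [LinearIndependent.pair_iff] at h ⊢
  intro x y hxy
  obtain ⟨h1, h2⟩ := h (x * c + y) x (by rw [← hxy]; module)
  subst h2
  exact ⟨rfl, by simpa using h1⟩

lemma squareOnLine_of_thetaLine (hli : LinearIndependent ℂ ![e₁, e₂, e₃])
    (hF : ∀ x y z : ℂ, eval (x • e₁ + y • e₂ + z • e₃) F = binodalForm w a b l m k p q r x y z)
    (hw : w ≠ 0) {s n : ℂ} (hs : s ≠ 0)
    (hT : ThetaLine F (lineThrough (e₁ + s • e₂) (n • e₂ + e₃))) :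
    SquareOnLine l m k p q r s (n + a - b * s) := by
  have hli' := linearIndependent_line hli s n
  obtain ⟨-, hT | hT⟩ := hT
  · have hu : e₁ + s • e₂ ≠ 0 := by simpa using hli'.ne_zero 0
    have h0 := @hT (Projectivization.mk ℂ _ hu) ⟨1, 0, by simpa using hu, by simp⟩ _ hu rfl
    have h1 := hF 1 s 0
    rw [one_smul, zero_smul, add_zero, h0] at h1
    simp [binodalForm, hw, hs] at h1
  obtain ⟨h, hh⟩ : ∃ h, h = n + a - b * s := ⟨_, rfl⟩
  rw [← hh]
  have hn : n = h - a + b * s := by rw [hh]; ring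
  subst hn
  have hsq : ∀ x : ℂ, x ^ 4 + (2 * h / s) * x ^ 3 +
      ((h ^ 2 + l + 2 * m * s + k * s ^ 2) / s ^ 2) * x ^ 2 +
      (2 * (m * h + k * s * h + p + q * s) / s ^ 2) * x +
      ((k * h ^ 2 + 2 * q * h + r) / s ^ 2) = 0 →
      4 * x ^ 3 + 3 * (2 * h / s) * x ^ 2 +
      2 * ((h ^ 2 + l + 2 * m * s + k * s ^ 2) / s ^ 2) * x +
      2 * (m * h + k * s * h + p + q * s) / s ^ 2 = 0 := by
    intro x hx
    set u := e₁ + s • e₂ with hu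
    set v := (h - a + b * s) • e₂ + e₃ with hv
    have hev : ∀ t : ℂ, eval (((x - b) • u + v) + t • u) F = w * s ^ 2 *
      ((x + t) ^ 4 + (2 * h / s) * (x + t) ^ 3 +
      ((h ^ 2 + l + 2 * m * s + k * s ^ 2) / s ^ 2) * (x + t) ^ 2 +
      (2 * (m * h + k * s * h + p + q * s) / s ^ 2) * (x + t) +
      ((k * h ^ 2 + 2 * q * h + r) / s ^ 2)) := by
      intro t
      have e : ((x - b) • u + v) + t • u = (x - b + t) • e₁ +
        ((x - b + t) * s + (h - a + b * s)) • e₂ + (1 : ℂ) • e₃ := by rw [hu, hv]; module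
      rw [e, hF, binodalForm]
      field_simp
      ring
    have hind := linearIndependent_add_smul hli' (x - b)
    have h0 : eval ((x - b) • u + v) F = 0 := by
      have := hev 0
      rw [zero_smul, add_zero, add_zero, hx, mul_zero] at this
      exact this
    have hne : (x - b) • u + v ≠ 0 := by simpa using hind.ne_zero 0
    have hmem : Projectivization.mk ℂ _ hne ∈ curve F := by
      intro y hy hyx
      obtain ⟨c, hc⟩ := exists_eq_of_mk_eq hyx
      have hc' : y = (c * (x - b)) • e₁ + (c * ((x - b) * s + (h - a + b * s))) • e₂ + c • e₃ := by
        rw [hc, hu, hv]; module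
      have h0' := hF (x - b) ((x - b) * s + (h - a + b * s)) 1
      have e : (x - b) • u + v = (x - b) • e₁ +
        ((x - b) * s + (h - a + b * s)) • e₂ + (1 : ℂ) • e₃ := by rw [hu, hv]; module
      rw [← e, h0, binodalForm] at h0'
      rw [hc', hF, binodalForm]
      linear_combination -c ^ 4 * h0'
    have h2 := coeff_eq_zero_of_two_le_multAt
      (hT _ _ hind (lineThrough_add_smul u v (x - b)) hne hmem)
    have hpoly : lineRest F ((x - b) • u + v) u = Polynomial.C (w * s ^ 2) *
      ((Polynomial.C x + Polynomial.X) ^ 4 +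
        Polynomial.C (2 * h / s) * (Polynomial.C x + Polynomial.X) ^ 3 +
        Polynomial.C ((h ^ 2 + l + 2 * m * s + k * s ^ 2) / s ^ 2) *
          (Polynomial.C x + Polynomial.X) ^ 2 +
        Polynomial.C (2 * (m * h + k * s * h + p + q * s) / s ^ 2) *
          (Polynomial.C x + Polynomial.X) +
        Polynomial.C ((k * h ^ 2 + 2 * q * h + r) / s ^ 2)) := by
      apply Polynomial.funext
      intro t
      rw [eval_lineRest, hev]
      simp only [Polynomial.eval_add, Polynomial.eval_mul, Polynomial.eval_C,
        Polynomial.eval_pow, Polynomial.eval_X]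
    have h3 : (Polynomial.derivative (lineRest F ((x - b) • u + v) u)).eval 0 = 0 := by
      rw [← Polynomial.coeff_zero_eq_eval_zero, Polynomial.coeff_derivative, h2, zero_mul]
    rw [hpoly] at h3
    simp only [Polynomial.derivative_mul, Polynomial.derivative_add, Polynomial.derivative_C,
      Polynomial.derivative_X, Polynomial.derivative_pow, Polynomial.eval_add,
      Polynomial.eval_mul, Polynomial.eval_C,
      Polynomial.eval_pow, Polynomial.eval_X, zero_mul, zero_add, add_zero, mul_one] at h3
    have h4 := (mul_eq_zero.mp h3).resolve_left (mul_ne_zero hw (pow_ne_zero 2 hs))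
    norm_num at h4
    linear_combination h4
  obtain ⟨B, C, h3, h2, h1, h0⟩ := exists_sq_of_roots_multiple hsq
  have hB : h = B * s := by
    field_simp at h3
    linear_combination h3
  subst hB
  refine ⟨s * C, ?_, ?_, ?_⟩
  · field_simp at h2
    linear_combination -h2
  · field_simp at h1
    linear_combination h1
  · field_simp at h0
    linear_combination h0

lemma thetaLine_of_squareOnLine (hli : LinearIndependent ℂ ![e₁, e₂, e₃])
    (hF : ∀ x y z : ℂ, eval (x • e₁ + y • e₂ + z • e₃) F = binodalForm w a b l m k p q r x y z)
    (hw : w ≠ 0) {s n : ℂ} (hs : s ≠ 0) (H : SquareOnLine l m k p q r s (n + a - b * s)) :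
    ThetaLine F (lineThrough (e₁ + s • e₂) (n • e₂ + e₃)) := by
  refine ⟨⟨_, _, linearIndependent_line hli s n, rfl⟩, Or.inr ?_⟩
  intro c d hcd hS hc0 hc
  obtain ⟨⟨α, β, rfl⟩, γ, δ, rfl⟩ := exists_eq_of_lineThrough_eq hS hcd
  have hdet : α * δ - β * γ ≠ 0 := by
    intro h
    rw [LinearIndependent.pair_iff] at hcd
    have hδ := hcd δ (-β) (by
      have e : δ • (α • (e₁ + s • e₂) + β • (n • e₂ + e₃)) +
        -β • (γ • (e₁ + s • e₂) + δ • (n • e₂ + e₃)) = (α * δ - β * γ) • (e₁ + s • e₂) := by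
        module
      rw [e, h, zero_smul])
    have hα := hcd γ (-α) (by
      have e : γ • (α • (e₁ + s • e₂) + β • (n • e₂ + e₃)) +
        -α • (γ • (e₁ + s • e₂) + δ • (n • e₂ + e₃)) = -(α * δ - β * γ) • (n • e₂ + e₃) := by
        module
      rw [e, h, neg_zero, zero_smul])
    apply hc0
    rw [neg_eq_zero.mp hδ.2, neg_eq_zero.mp hα.2]
    simp
  obtain ⟨h, hh⟩ : ∃ h, h = n + a - b * s := ⟨_, rfl⟩
  rw [← hh] at H
  have hn : n = h - a + b * s := by rw [hh]; ring
  obtain ⟨f, h1, h2, h3⟩ := H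
  have hev : ∀ x z : ℂ, eval (x • (e₁ + s • e₂) + z • (n • e₂ + e₃)) F =
      w * (s * (x + b * z) ^ 2 + h * (x + b * z) * z + f * z ^ 2) ^ 2 := by
    intro x z
    have e : x • (e₁ + s • e₂) + z • (n • e₂ + e₃) = x • e₁ + (x * s + z * n) • e₂ + z • e₃ := by
      module
    rw [e, hF, binodalForm, hn]
    linear_combination -w * (x + b * z) ^ 2 * z ^ 2 * h1 + 2 * w * (x + b * z) * z ^ 3 * h2 +
      w * z ^ 4 * h3
  set q₀ := s * (α + b * β) ^ 2 + h * (α + b * β) * β + f * β ^ 2 with hq₀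
  set q₁ := 2 * s * (α + b * β) * (γ + b * δ) + h * ((α + b * β) * δ + (γ + b * δ) * β) +
    2 * f * β * δ with hq₁
  set q₂ := s * (γ + b * δ) ^ 2 + h * (γ + b * δ) * δ + f * δ ^ 2 with hq₂
  have hq₀0 : q₀ = 0 := by
    have h0 := hc _ hc0 rfl
    rw [hev, ← hq₀] at h0
    simpa [hw] using h0
  have hpoly : lineRest F (α • (e₁ + s • e₂) + β • (n • e₂ + e₃))
      (γ • (e₁ + s • e₂) + δ • (n • e₂ + e₃)) =
      Polynomial.X ^ 2 * (Polynomial.C w * (Polynomial.C q₁ + Polynomial.C q₂ * Polynomial.X) ^ 2)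
      := by
    apply Polynomial.funext
    intro t
    rw [eval_lineRest]
    have e : α • (e₁ + s • e₂) + β • (n • e₂ + e₃) + t • (γ • (e₁ + s • e₂) + δ • (n • e₂ + e₃)) =
      (α + t * γ) • (e₁ + s • e₂) + (β + t * δ) • (n • e₂ + e₃) := by module
    rw [e, hev]
    have e2 : s * (α + t * γ + b * (β + t * δ)) ^ 2 +
      h * (α + t * γ + b * (β + t * δ)) * (β + t * δ) + f * (β + t * δ) ^ 2 =
      q₀ + t * (q₁ + q₂ * t) := by rw [hq₀, hq₁, hq₂]; ring
    rw [e2, hq₀0]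
    simp
    ring
  have hne : Polynomial.C q₁ + Polynomial.C q₂ * Polynomial.X ≠ 0 := by
    intro h0
    have hq₁0 : q₁ = 0 := by simpa using congrArg (fun P => Polynomial.coeff P 0) h0
    have hq₂0 : q₂ = 0 := by simpa using congrArg (fun P => Polynomial.coeff P 1) h0
    have : s * (α * δ - β * γ) ^ 2 = 0 := by
      linear_combination δ ^ 2 * hq₀0 - β * δ * hq₁0 + β ^ 2 * hq₂0
    exact mul_ne_zero hs (pow_ne_zero 2 hdet) this
  rw [multAt, hpoly, Polynomial.le_rootMultiplicity_iff]
  · simp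
  · exact mul_ne_zero (pow_ne_zero 2 Polynomial.X_ne_zero)
      (mul_ne_zero (by simpa using hw) (pow_ne_zero 2 hne))

end ThetaLines

lemma coeff_zero_lineRest (F : MvPolynomial (Fin 3) ℂ) (a b : Fin 3 → ℂ) :
    (lineRest F a b).coeff 0 = eval a F := by
  rw [Polynomial.coeff_zero_eq_eval_zero, eval_lineRest, zero_smul, add_zero]

lemma coeff_one_lineRest (F : MvPolynomial (Fin 3) ℂ) (a b : Fin 3 → ℂ) :
    (lineRest F a b).coeff 1 = ∑ i, b i * eval a (pderiv i F) := by
  induction F using MvPolynomial.induction_on with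
  | C c => simp [lineRest]
  | add f g hf hg =>
    have h : lineRest (f + g) a b = lineRest f a b + lineRest g a b := eval₂_add _ _
    simp [h, hf, hg, mul_add, Finset.sum_add_distrib]
  | mul_X f j hf =>
    have h : lineRest (f * X j) a b =
        lineRest f a b * (Polynomial.C (a j) + Polynomial.X * Polynomial.C (b j)) := by
      simp [lineRest, eval₂_mul]
    rw [h, Polynomial.mul_coeff_one, coeff_zero_lineRest, hf]
    simp [Derivation.leibniz, pderiv_X, Pi.single_apply, mul_add, Finset.sum_add_distrib,
      Finset.sum_mul, apply_ite]
    rw [mul_comm (b j)]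
    congr 1
    exact Finset.sum_congr rfl fun i _ => by ring

lemma IsSingularAt.coeff_lineRest {F : MvPolynomial (Fin 3) ℂ} {p : P2} (h : IsSingularAt F p)
    {e : Fin 3 → ℂ} (he : e ≠ 0) (hp : Projectivization.mk ℂ e he = p) (b : Fin 3 → ℂ) :
    (lineRest F e b).coeff 0 = 0 ∧ (lineRest F e b).coeff 1 = 0 := by
  constructor
  · rw [coeff_zero_lineRest]
    exact h [] (by simp) e he hp
  · rw [coeff_one_lineRest]
    refine Finset.sum_eq_zero fun i _ => ?_
    rw [show eval e (pderiv i F) = 0 from h [i] (by simp) e he hp, mul_zero]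

/-- The exponent vector `(i, j, k)`. -/
def exponent (i j k : ℕ) : Fin 3 →₀ ℕ := Finsupp.equivFunOnFinite.symm ![i, j, k]

lemma eval_quartic {F : MvPolynomial (Fin 3) ℂ} (hF : F.IsHomogeneous 4) (x y z : ℂ) :
    eval ![x, y, z] F = ∑ i ∈ Finset.range 5, ∑ j ∈ Finset.range (5 - i),
      coeff (exponent i j (4 - i - j)) F * (x ^ i * y ^ j * z ^ (4 - i - j)) := by
  rw [eval_eq', Finset.sum_sigma']
  symm
  apply Finset.sum_bij_ne_zero (fun s _ _ => exponent s.1 s.2 (4 - s.1 - s.2))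
  · rintro ⟨i, j⟩ - h
    rw [mem_support_iff]
    exact left_ne_zero_of_mul h
  · rintro ⟨i, j⟩ - - ⟨i', j'⟩ - - h
    have h0 := DFunLike.congr_fun h 0
    have h1 := DFunLike.congr_fun h 1
    simp [exponent] at h0 h1
    subst h0 h1
    rfl
  · intro d hd hd'
    have h4 := hF (mem_support_iff.mp hd)
    simp [Finsupp.weight_apply, Finsupp.sum_fintype, Fin.sum_univ_three] at h4
    have he : exponent (d 0) (d 1) (4 - d 0 - d 1) = d := by
      ext i
      fin_cases i <;> simp [exponent]
      omega
    refine ⟨⟨d 0, d 1⟩, ?_, ?_, he⟩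
    · simp
      omega
    · simp only [he]
      have h2 : 4 - d 0 - d 1 = d 2 := by omega
      simpa [Fin.prod_univ_three, h2] using hd'
  · rintro ⟨i, j⟩ - -
    simp [exponent, Fin.prod_univ_three]

section Coordinates

variable (e₁ e₂ e₃ : Fin 3 → ℂ)

/-- The substitution expressing a form in the coordinates with respect to `e₁, e₂, e₃`. -/
def coordPullback : MvPolynomial (Fin 3) ℂ →ₐ[ℂ] MvPolynomial (Fin 3) ℂ :=
  aeval fun i => C (e₁ i) * X 0 + C (e₂ i) * X 1 + C (e₃ i) * X 2

lemma eval_coordPullback (F : MvPolynomial (Fin 3) ℂ) (x y z : ℂ) :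
    eval ![x, y, z] (coordPullback e₁ e₂ e₃ F) = eval (x • e₁ + y • e₂ + z • e₃) F := by
  have h : (eval ![x, y, z]).comp (coordPullback e₁ e₂ e₃ : _ →+* _) =
      eval (x • e₁ + y • e₂ + z • e₃) := by
    ext i <;> simp [coordPullback]
    ring
  exact congrArg (fun φ => φ F) h

lemma isHomogeneous_coordPullback {F : MvPolynomial (Fin 3) ℂ} {n : ℕ} (hF : F.IsHomogeneous n) :
    (coordPullback e₁ e₂ e₃ F).IsHomogeneous n := by
  have h : ∀ i, (C (e₁ i) * X 0 + C (e₂ i) * X 1 + C (e₃ i) * X 2 :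
      MvPolynomial (Fin 3) ℂ).IsHomogeneous 1 := fun i =>
    ((isHomogeneous_C_mul_X _ _).add (isHomogeneous_C_mul_X _ _)).add (isHomogeneous_C_mul_X _ _)
  simpa [coordPullback] using hF.aeval _ h

/-- The coefficient of `x^i y^j z^k` of a form in the coordinates with respect to
`e₁, e₂, e₃`. -/
def coordCoeff (i j k : ℕ) : MvPolynomial (Fin 3) ℂ →ₗ[ℂ] ℂ :=
  lcoeff ℂ (exponent i j k) ∘ₗ (coordPullback e₁ e₂ e₃).toLinearMap

variable {e₁ e₂ e₃} {F : MvPolynomial (Fin 3) ℂ}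

lemma eval_eq_sum_coordCoeff (hF : F.IsHomogeneous 4) (x y z : ℂ) :
    eval (x • e₁ + y • e₂ + z • e₃) F = ∑ i ∈ Finset.range 5, ∑ j ∈ Finset.range (5 - i),
      coordCoeff e₁ e₂ e₃ i j (4 - i - j) F * (x ^ i * y ^ j * z ^ (4 - i - j)) := by
  rw [← eval_coordPullback, eval_quartic (isHomogeneous_coordPullback e₁ e₂ e₃ hF)]
  rfl

lemma eval_eq_of_isSingularAt (hF : F.IsHomogeneous 4) {p₁ p₂ : P2} (h₁ : e₁ ≠ 0) (h₂ : e₂ ≠ 0)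
    (hp₁ : Projectivization.mk ℂ e₁ h₁ = p₁) (hp₂ : Projectivization.mk ℂ e₂ h₂ = p₂)
    (hs₁ : IsSingularAt F p₁) (hs₂ : IsSingularAt F p₂) (x y z : ℂ) :
    eval (x • e₁ + y • e₂ + z • e₃) F =
      coordCoeff e₁ e₂ e₃ 2 2 0 F * x ^ 2 * y ^ 2 + coordCoeff e₁ e₂ e₃ 2 1 1 F * x ^ 2 * y * z +
      coordCoeff e₁ e₂ e₃ 1 2 1 F * x * y ^ 2 * z + coordCoeff e₁ e₂ e₃ 2 0 2 F * x ^ 2 * z ^ 2 +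
      coordCoeff e₁ e₂ e₃ 1 1 2 F * x * y * z ^ 2 + coordCoeff e₁ e₂ e₃ 0 2 2 F * y ^ 2 * z ^ 2 +
      coordCoeff e₁ e₂ e₃ 1 0 3 F * x * z ^ 3 + coordCoeff e₁ e₂ e₃ 0 1 3 F * y * z ^ 3 +
      coordCoeff e₁ e₂ e₃ 0 0 4 F * z ^ 4 := by
  have hev := eval_eq_sum_coordCoeff (e₁ := e₁) (e₂ := e₂) (e₃ := e₃) hF
  simp only [Finset.sum_range_succ, Finset.sum_range_zero, Nat.reduceSub,
    zero_add, pow_zero, pow_one, mul_one, one_mul] at hev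
  have key : ∀ (e b : Fin 3 → ℂ) (c : Fin 5 → ℂ),
      (∀ t : ℂ, eval (e + t • b) F = ∑ i, c i * t ^ (i : ℕ)) →
      (lineRest F e b).coeff 0 = 0 ∧ (lineRest F e b).coeff 1 = 0 → c 0 = 0 ∧ c 1 = 0 := by
    intro e b c hc h
    have hl : lineRest F e b = ∑ i, Polynomial.C (c i) * Polynomial.X ^ (i : ℕ) := by
      apply Polynomial.funext
      intro t
      rw [eval_lineRest, hc]
      simp [Polynomial.eval_finsetSum]
    rw [hl] at h
    simpa [Fin.sum_univ_five, Polynomial.coeff_X_pow, Polynomial.coeff_X,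
      Polynomial.coeff_C] using h
  obtain ⟨h400, h310⟩ := key e₁ e₂ ![coordCoeff e₁ e₂ e₃ 4 0 0 F, coordCoeff e₁ e₂ e₃ 3 1 0 F,
      coordCoeff e₁ e₂ e₃ 2 2 0 F, coordCoeff e₁ e₂ e₃ 1 3 0 F, coordCoeff e₁ e₂ e₃ 0 4 0 F]
    (fun t => by
      have h := hev 1 t 0
      rw [one_smul, zero_smul, add_zero] at h
      rw [h]
      simp [Fin.sum_univ_five]
      ring) (hs₁.coeff_lineRest h₁ hp₁ e₂)
  obtain ⟨-, h301⟩ := key e₁ e₃ ![coordCoeff e₁ e₂ e₃ 4 0 0 F, coordCoeff e₁ e₂ e₃ 3 0 1 F,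
      coordCoeff e₁ e₂ e₃ 2 0 2 F, coordCoeff e₁ e₂ e₃ 1 0 3 F, coordCoeff e₁ e₂ e₃ 0 0 4 F]
    (fun t => by
      have h := hev 1 0 t
      rw [one_smul, zero_smul, add_zero] at h
      rw [h]
      simp [Fin.sum_univ_five]
      ring) (hs₁.coeff_lineRest h₁ hp₁ e₃)
  obtain ⟨h040, h130⟩ := key e₂ e₁ ![coordCoeff e₁ e₂ e₃ 0 4 0 F, coordCoeff e₁ e₂ e₃ 1 3 0 F,
      coordCoeff e₁ e₂ e₃ 2 2 0 F, coordCoeff e₁ e₂ e₃ 3 1 0 F, coordCoeff e₁ e₂ e₃ 4 0 0 F]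
    (fun t => by
      have h := hev t 1 0
      rw [one_smul, zero_smul, add_zero, add_comm] at h
      rw [h]
      simp [Fin.sum_univ_five]) (hs₂.coeff_lineRest h₂ hp₂ e₁)
  obtain ⟨-, h031⟩ := key e₂ e₃ ![coordCoeff e₁ e₂ e₃ 0 4 0 F, coordCoeff e₁ e₂ e₃ 0 3 1 F,
      coordCoeff e₁ e₂ e₃ 0 2 2 F, coordCoeff e₁ e₂ e₃ 0 1 3 F, coordCoeff e₁ e₂ e₃ 0 0 4 F]
    (fun t => by
      have h := hev 0 1 t
      rw [one_smul, zero_smul, zero_add] at h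
      rw [h]
      simp [Fin.sum_univ_five]
      ring) (hs₂.coeff_lineRest h₂ hp₂ e₃)
  simp only [Matrix.cons_val] at h400 h310 h301 h040 h130 h031
  rw [hev, h400, h310, h301, h040, h130, h031]
  ring

end Coordinates

/-- The centred parameters `l, m, k, p, q, r` of the form
`x²y² + 2 a x²yz + 2 b xy²z + L x²z² + 2 M xyz² + N y²z² + 2 P xz³ + 2 Q yz³ + R z⁴`
with `v = (a, b, L, M, N, P, Q, R)`. -/
def centredParams {K : Type*} [CommRing K] (v : Fin 8 → K) : Fin 6 → K :=
  ![v 2 - v 0 ^ 2, v 3 - 2 * v 0 * v 1, v 4 - v 1 ^ 2,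
    v 5 - v 0 * (v 3 - v 0 * v 1) - v 1 * (v 2 - v 0 ^ 2),
    v 6 - v 1 * (v 3 - v 0 * v 1) - v 0 * (v 4 - v 1 ^ 2),
    v 7 - 3 * v 0 ^ 2 * v 1 ^ 2 + v 2 * v 1 ^ 2 + 2 * v 3 * v 0 * v 1 + v 4 * v 0 ^ 2 -
      2 * v 5 * v 1 - 2 * v 6 * v 0]

lemma map_centredParams {K K' : Type*} [CommRing K] [CommRing K'] (φ : K →+* K') (v : Fin 8 → K)
    (i : Fin 6) : φ (centredParams v i) = centredParams (fun j => φ (v j)) i := by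
  fin_cases i <;> simp [centredParams, map_ofNat φ]

/-- A polynomial in the centred parameters whose nonvanishing ensures that the quartic is
determined by its theta-lines. -/
def genericity {K : Type*} [CommRing K] (c : Fin 6 → K) : K :=
  c 0 * c 2 * (c 3 ^ 2 * c 2 - c 4 ^ 2 * c 0) *
    (thetaOctic (c 0) (c 1) (c 2) (c 3) (c 4) (c 5)).resultant
      (Polynomial.derivative (thetaOctic (c 0) (c 1) (c 2) (c 3) (c 4) (c 5))) 8 7

lemma map_genericity {K K' : Type*} [CommRing K] [CommRing K'] (φ : K →+* K') (c : Fin 6 → K) :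
    φ (genericity c) = genericity (fun i => φ (c i)) := by
  simp only [genericity, map_mul, map_sub, map_pow, ← Polynomial.resultant_map_map]
  rw [← Polynomial.derivative_map, thetaOctic_map]

lemma genericity_ne_zero_iff (c : Fin 6 → ℂ) : genericity c ≠ 0 ↔
    c 0 ≠ 0 ∧ c 2 ≠ 0 ∧ c 3 ^ 2 * c 2 - c 4 ^ 2 * c 0 ≠ 0 ∧
      (thetaOctic (c 0) (c 1) (c 2) (c 3) (c 4) (c 5)).Separable := by
  rw [genericity, mul_ne_zero_iff, mul_ne_zero_iff, mul_ne_zero_iff, and_assoc, and_assoc]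
  refine and_congr_right fun _ => and_congr_right fun h2 => and_congr_right fun _ => ?_
  have hd := thetaOctic_natDegree (c 0) (c 1) (c 2) (c 3) (c 4) (c 5) h2
  have hd' : (Polynomial.derivative
      (thetaOctic (c 0) (c 1) (c 2) (c 3) (c 4) (c 5))).natDegree = 7 := by
    rw [Polynomial.natDegree_derivative, hd]
  have h0 : thetaOctic (c 0) (c 1) (c 2) (c 3) (c 4) (c 5) ≠ 0 := by
    intro h
    rw [h, Polynomial.natDegree_zero] at hd
    norm_num at hd
  have h := Polynomial.resultant_eq_zero_iff
    (f := thetaOctic (c 0) (c 1) (c 2) (c 3) (c 4) (c 5))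
    (g := Polynomial.derivative (thetaOctic (c 0) (c 1) (c 2) (c 3) (c 4) (c 5)))
  rw [hd, hd'] at h
  rw [Ne, h, Polynomial.Separable]
  simp [h0]

/-- The linear form in the coefficients of a quartic form representing a linear functional. -/
def linearForm (φ : MvPolynomial (Fin 3) ℂ →ₗ[ℂ] ℂ) : MvPolynomial (Fin 3 →₀ ℕ) ℂ :=
  ∑ d ∈ Finset.finsuppAntidiag Finset.univ 4, C (φ (monomial d 1)) * X d

lemma isHomogeneous_linearForm (φ : MvPolynomial (Fin 3) ℂ →ₗ[ℂ] ℂ) :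
    (linearForm φ).IsHomogeneous 1 :=
  IsHomogeneous.sum _ _ _ fun _ _ => isHomogeneous_C_mul_X _ _

lemma eval_linearForm (φ : MvPolynomial (Fin 3) ℂ →ₗ[ℂ] ℂ) {F : MvPolynomial (Fin 3) ℂ}
    (hF : F.IsHomogeneous 4) : eval (fun m => coeff m F) (linearForm φ) = φ F := by
  have hsub : F.support ⊆ Finset.finsuppAntidiag Finset.univ 4 := by
    intro d hd
    have h4 := hF (mem_support_iff.mp hd)
    rw [Finset.mem_finsuppAntidiag]
    refine ⟨?_, Finset.subset_univ _⟩
    simpa [Finsupp.weight_apply, Finsupp.sum_fintype] using h4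
  conv_rhs => rw [F.as_sum, map_sum]
  rw [linearForm, map_sum]
  symm
  apply Finset.sum_subset_zero_on_sdiff hsub
  · intro d hd
    simp [notMem_support_iff.mp (Finset.mem_sdiff.mp hd).2]
  · intro d _
    rw [show monomial d (coeff d F) = coeff d F • monomial d (1 : ℂ) by simp [smul_monomial]]
    simp [mul_comm]

lemma exists_homogenization {σ τ : Type*} (P : MvPolynomial σ ℂ) (W : MvPolynomial τ ℂ)
    (Y : σ → MvPolynomial τ ℂ) (hW : W.IsHomogeneous 1) (hY : ∀ i, (Y i).IsHomogeneous 1) :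
    ∃ (Q : MvPolynomial τ ℂ) (n : ℕ), Q.IsHomogeneous n ∧ ∀ c : τ → ℂ,
      eval c Q ≠ 0 ↔ eval c W ≠ 0 ∧ eval (fun i => eval c (Y i) / eval c W) P ≠ 0 := by
  refine ⟨W * ∑ j ∈ Finset.range (P.totalDegree + 1),
    W ^ (P.totalDegree - j) * aeval Y (homogeneousComponent j P), 1 + P.totalDegree, ?_, ?_⟩
  · refine hW.mul (IsHomogeneous.sum _ _ _ fun j hj => ?_)
    have h1 : j ≤ P.totalDegree := by
      rw [Finset.mem_range] at hj
      omega
    have h := (hW.pow (P.totalDegree - j)).mul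
      ((homogeneousComponent_isHomogeneous j P).aeval Y hY)
    rwa [one_mul, one_mul, Nat.sub_add_cancel h1] at h
  · intro c
    rw [map_mul, mul_ne_zero_iff]
    refine and_congr_right fun hw => ?_
    have hcomp : (eval c).comp (aeval (R := ℂ) Y : _ →+* _) =
        eval fun i => eval c (Y i) := by
      ext <;> simp
    have hscale : ∀ j, eval c (aeval Y (homogeneousComponent j P)) =
        eval c W ^ j * eval (fun i => eval c (Y i) / eval c W) (homogeneousComponent j P) := by
      intro j
      rw [show eval c (aeval Y (homogeneousComponent j P)) =
        eval (fun i => eval c (Y i)) (homogeneousComponent j P) from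
          congrArg (fun φ => φ (homogeneousComponent j P)) hcomp]
      generalize eval c W = t at hw ⊢
      rw [eval_eq, eval_eq, Finset.mul_sum]
      refine Finset.sum_congr rfl fun d hd => ?_
      have hj := homogeneousComponent_isHomogeneous j P (mem_support_iff.mp hd)
      rw [Finsupp.weight_apply] at hj
      simp only [Pi.one_apply, smul_eq_mul, mul_one, Finsupp.sum] at hj
      rw [← hj, ← Finset.prod_pow_eq_pow_sum, mul_left_comm, ← Finset.prod_mul_distrib]
      congr 1
      refine Finset.prod_congr rfl fun i _ => ?_
      rw [← mul_pow, mul_div_cancel₀ _ hw]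
    have hP : eval c (∑ j ∈ Finset.range (P.totalDegree + 1),
        W ^ (P.totalDegree - j) * aeval Y (homogeneousComponent j P)) =
        eval c W ^ P.totalDegree * eval (fun i => eval c (Y i) / eval c W) P := by
      have h := congrArg (eval fun i => eval c (Y i) / eval c W) (sum_homogeneousComponent P)
      rw [← h, map_sum, map_sum, Finset.mul_sum]
      refine Finset.sum_congr rfl fun j hj => ?_
      have h1 : j ≤ P.totalDegree := by
        rw [Finset.mem_range] at hj
        omega
      rw [map_mul, map_pow, hscale, ← mul_assoc, ← pow_add, Nat.sub_add_cancel h1]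
    rw [hP]
    simp [hw]

section NormalForm

variable (e₁ e₂ e₃ : Fin 3 → ℂ)

/-- The coefficient functionals `a, b, L, M, N, P, Q, R` of a binodal quartic
`w x²y² + 2 a x²yz + 2 b xy²z + L x²z² + 2 M xyz² + N y²z² + 2 P xz³ + 2 Q yz³ + R z⁴`. -/
def nodalCoeff : Fin 8 → MvPolynomial (Fin 3) ℂ →ₗ[ℂ] ℂ :=
  ![(1 / 2 : ℂ) • coordCoeff e₁ e₂ e₃ 2 1 1, (1 / 2 : ℂ) • coordCoeff e₁ e₂ e₃ 1 2 1,
    coordCoeff e₁ e₂ e₃ 2 0 2, (1 / 2 : ℂ) • coordCoeff e₁ e₂ e₃ 1 1 2,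
    coordCoeff e₁ e₂ e₃ 0 2 2, (1 / 2 : ℂ) • coordCoeff e₁ e₂ e₃ 1 0 3,
    (1 / 2 : ℂ) • coordCoeff e₁ e₂ e₃ 0 1 3, coordCoeff e₁ e₂ e₃ 0 0 4]

/-- In the coordinates with respect to `e₁, e₂, e₃` the form `F` is a quartic form singular at
the first two coordinate points. -/
def IsBinodal (F : MvPolynomial (Fin 3) ℂ) : Prop :=
  ∀ x y z : ℂ, eval (x • e₁ + y • e₂ + z • e₃) F =
    coordCoeff e₁ e₂ e₃ 2 2 0 F * x ^ 2 * y ^ 2 + 2 * nodalCoeff e₁ e₂ e₃ 0 F * x ^ 2 * y * z +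
      2 * nodalCoeff e₁ e₂ e₃ 1 F * x * y ^ 2 * z + nodalCoeff e₁ e₂ e₃ 2 F * x ^ 2 * z ^ 2 +
      2 * nodalCoeff e₁ e₂ e₃ 3 F * x * y * z ^ 2 + nodalCoeff e₁ e₂ e₃ 4 F * y ^ 2 * z ^ 2 +
      2 * nodalCoeff e₁ e₂ e₃ 5 F * x * z ^ 3 + 2 * nodalCoeff e₁ e₂ e₃ 6 F * y * z ^ 3 +
      nodalCoeff e₁ e₂ e₃ 7 F * z ^ 4

/-- The centred parameters of a binodal quartic form, normalized by the coefficient of `x²y²`. -/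
def quarticParams (F : MvPolynomial (Fin 3) ℂ) : Fin 6 → ℂ :=
  centredParams fun i => nodalCoeff e₁ e₂ e₃ i F / coordCoeff e₁ e₂ e₃ 2 2 0 F

variable {e₁ e₂ e₃} {F : MvPolynomial (Fin 3) ℂ}

lemma isBinodal_of_isSingularAt (hF : F.IsHomogeneous 4) {p₁ p₂ : P2} (h₁ : e₁ ≠ 0)
    (h₂ : e₂ ≠ 0) (hp₁ : Projectivization.mk ℂ e₁ h₁ = p₁)
    (hp₂ : Projectivization.mk ℂ e₂ h₂ = p₂)
    (hs₁ : IsSingularAt F p₁) (hs₂ : IsSingularAt F p₂) : IsBinodal e₁ e₂ e₃ F := by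
  intro x y z
  rw [eval_eq_of_isSingularAt hF h₁ h₂ hp₁ hp₂ hs₁ hs₂]
  simp [nodalCoeff]

lemma IsBinodal.eval_eq_binodalForm (hF : IsBinodal e₁ e₂ e₃ F) {w : ℂ}
    (hw : coordCoeff e₁ e₂ e₃ 2 2 0 F = w) (hw0 : w ≠ 0) (x y z : ℂ) :
    eval (x • e₁ + y • e₂ + z • e₃) F =
      binodalForm w (nodalCoeff e₁ e₂ e₃ 0 F / w) (nodalCoeff e₁ e₂ e₃ 1 F / w)
        (quarticParams e₁ e₂ e₃ F 0) (quarticParams e₁ e₂ e₃ F 1) (quarticParams e₁ e₂ e₃ F 2)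
        (quarticParams e₁ e₂ e₃ F 3) (quarticParams e₁ e₂ e₃ F 4) (quarticParams e₁ e₂ e₃ F 5)
        x y z := by
  rw [hF, binodalForm, quarticParams, hw]
  simp only [centredParams, Matrix.cons_val]
  field_simp
  ring

lemma exists_coordForms (hli : LinearIndependent ℂ ![e₁, e₂, e₃]) :
    ∃ ξ η ζ : MvPolynomial (Fin 3) ℂ,
      ξ.IsHomogeneous 1 ∧ η.IsHomogeneous 1 ∧ ζ.IsHomogeneous 1 ∧
      (∀ x y z : ℂ, eval (x • e₁ + y • e₂ + z • e₃) ξ = x) ∧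
      (∀ x y z : ℂ, eval (x • e₁ + y • e₂ + z • e₃) η = y) ∧
      ∀ x y z : ℂ, eval (x • e₁ + y • e₂ + z • e₃) ζ = z := by
  have key : ∀ c : Fin 3 → ℂ, ∃ ξ : MvPolynomial (Fin 3) ℂ, ξ.IsHomogeneous 1 ∧
      ∀ x y z : ℂ, eval (x • e₁ + y • e₂ + z • e₃) ξ = x * c 0 + y * c 1 + z * c 2 := by
    intro c
    set b := basisOfLinearIndependentOfCardEqFinrank hli (by simp) with hb
    set f : (Fin 3 → ℂ) →ₗ[ℂ] ℂ := b.constr ℂ c with hf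
    refine ⟨∑ j, C (f (Pi.single j 1)) * X j,
      IsHomogeneous.sum _ _ _ fun _ _ => isHomogeneous_C_mul_X _ _, fun x y z => ?_⟩
    have hv : ∀ v : Fin 3 → ℂ, eval v (∑ j, C (f (Pi.single j 1)) * X j) = f v := by
      intro v
      conv_rhs => rw [← Finset.univ_sum_single v, map_sum]
      rw [map_sum]
      refine Finset.sum_congr rfl fun j _ => ?_
      rw [map_mul, eval_C, eval_X, mul_comm, ← smul_eq_mul, ← map_smul, ← Pi.single_smul,
        smul_eq_mul, mul_one]
    have hfb : ∀ i, f (![e₁, e₂, e₃] i) = c i := by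
      intro i
      rw [hf, ← coe_basisOfLinearIndependentOfCardEqFinrank hli (by simp), ← hb,
        Module.Basis.constr_basis]
    have h0 := hfb 0
    have h1 := hfb 1
    have h2 := hfb 2
    simp only [Matrix.cons_val] at h0 h1 h2
    rw [hv, map_add, map_add, map_smul, map_smul, map_smul, h0, h1, h2]
    simp
  obtain ⟨ξ, hξ, hξ'⟩ := key ![1, 0, 0]
  obtain ⟨η, hη, hη'⟩ := key ![0, 1, 0]
  obtain ⟨ζ, hζ, hζ'⟩ := key ![0, 0, 1]
  exact ⟨ξ, η, ζ, hξ, hη, hζ, by simpa using hξ', by simpa using hη', by simpa using hζ'⟩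

lemma eq_of_forall_eval_eq (hli : LinearIndependent ℂ ![e₁, e₂, e₃])
    {F G : MvPolynomial (Fin 3) ℂ}
    (h : ∀ x y z : ℂ, eval (x • e₁ + y • e₂ + z • e₃) F = eval (x • e₁ + y • e₂ + z • e₃) G) :
    F = G := by
  apply MvPolynomial.funext
  intro v
  have hv : v ∈ Submodule.span ℂ (Set.range ![e₁, e₂, e₃]) := by
    rw [hli.span_eq_top_of_card_eq_finrank (by simp)]
    trivial
  obtain ⟨c, rfl⟩ := (Submodule.mem_span_range_iff_exists_fun ℂ).mp hv
  simpa [Fin.sum_univ_three] using h (c 0) (c 1) (c 2)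

lemma not_irreducible_mul_of_eval_zero {A B : MvPolynomial (Fin 3) ℂ} (hA : eval 0 A = 0)
    (hB : eval 0 B = 0) : ¬ Irreducible (A * B) := by
  have key : ∀ f : MvPolynomial (Fin 3) ℂ, eval 0 f = 0 → ¬ IsUnit f := by
    intro f hf hu
    have := hu.map (eval 0)
    rw [hf] at this
    exact not_isUnit_zero this
  intro h
  exact (h.isUnit_or_isUnit rfl).elim (key A hA) (key B hB)

lemma IsBinodal.coordCoeff_ne_zero (hli : LinearIndependent ℂ ![e₁, e₂, e₃])
    (hF : IsBinodal e₁ e₂ e₃ F) (hirr : Irreducible F) : coordCoeff e₁ e₂ e₃ 2 2 0 F ≠ 0 := by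
  intro hw
  obtain ⟨ξ, η, ζ, -, -, -, hξ', hη', hζ'⟩ := exists_coordForms hli
  have h0 : F = ζ * (C (2 * nodalCoeff e₁ e₂ e₃ 0 F) * ξ ^ 2 * η +
      C (2 * nodalCoeff e₁ e₂ e₃ 1 F) * ξ * η ^ 2 + C (nodalCoeff e₁ e₂ e₃ 2 F) * ξ ^ 2 * ζ +
      C (2 * nodalCoeff e₁ e₂ e₃ 3 F) * ξ * η * ζ + C (nodalCoeff e₁ e₂ e₃ 4 F) * η ^ 2 * ζ +
      C (2 * nodalCoeff e₁ e₂ e₃ 5 F) * ξ * ζ ^ 2 + C (2 * nodalCoeff e₁ e₂ e₃ 6 F) * η * ζ ^ 2 +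
      C (nodalCoeff e₁ e₂ e₃ 7 F) * ζ ^ 3) := by
    apply eq_of_forall_eval_eq hli
    intro x y z
    rw [hF, hw]
    simp only [map_add, map_mul, map_pow, eval_C, hξ', hη', hζ']
    ring
  have hz : eval 0 ξ = 0 ∧ eval 0 η = 0 ∧ eval 0 ζ = 0 := by
    have h1 := hξ' 0 0 0
    have h2 := hη' 0 0 0
    have h3 := hζ' 0 0 0
    simp only [zero_smul, add_zero] at h1 h2 h3
    exact ⟨h1, h2, h3⟩
  rw [h0] at hirr
  exact not_irreducible_mul_of_eval_zero hz.2.2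
    (by simp only [map_add, map_mul, map_pow, hz.1, hz.2.1, hz.2.2]; simp) hirr

lemma not_irreducible_of_eval_eq_binodalForm (hli : LinearIndependent ℂ ![e₁, e₂, e₃])
    {w a b m : ℂ} (hF : ∀ x y z : ℂ, eval (x • e₁ + y • e₂ + z • e₃) F =
      binodalForm w a b 0 m 0 0 0 (m ^ 2) x y z) : ¬ Irreducible F := by
  obtain ⟨ξ, η, ζ, -, -, -, hξ', hη', hζ'⟩ := exists_coordForms hli
  have h0 : F = (C w * ((ξ + C b * ζ) * (η + C a * ζ) + C m * ζ ^ 2)) *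
      ((ξ + C b * ζ) * (η + C a * ζ) + C m * ζ ^ 2) := by
    apply eq_of_forall_eval_eq hli
    intro x y z
    rw [hF, binodalForm]
    simp only [map_add, map_mul, map_pow, eval_C, hξ', hη', hζ']
    ring
  have h1 := hξ' 0 0 0
  have h2 := hη' 0 0 0
  have h3 := hζ' 0 0 0
  simp only [zero_smul, add_zero] at h1 h2 h3
  rw [h0]
  apply not_irreducible_mul_of_eval_zero <;> simp only [map_add, map_mul, map_pow, h1, h2, h3] <;>
    ring

/-- Two binodal quartics, one of them generic, the other irreducible, with the same nodes are
proportional if the theta-lines of the first are theta-lines of the second. -/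
lemma IsBinodal.exists_eq_smul (hli : LinearIndependent ℂ ![e₁, e₂, e₃])
    {G : MvPolynomial (Fin 3) ℂ} (hF : IsBinodal e₁ e₂ e₃ F) (hG : IsBinodal e₁ e₂ e₃ G)
    (hw : coordCoeff e₁ e₂ e₃ 2 2 0 F ≠ 0) (hgen : genericity (quarticParams e₁ e₂ e₃ F) ≠ 0)
    (hirr : Irreducible G) (hT : ∀ S, ThetaLine F S → ThetaLine G S) :
    ∃ c : ℂ, c ≠ 0 ∧ G = c • F := by
  have hw' := hG.coordCoeff_ne_zero hli hirr
  have hF' := hF.eval_eq_binodalForm rfl hw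
  have hG' := hG.eval_eq_binodalForm rfl hw'
  obtain ⟨hl, hk, hpq, hsep⟩ := (genericity_ne_zero_iff _).mp hgen
  rcases params_eq_of_squareOnLine hl hk hpq hsep (fun s n hs h =>
    squareOnLine_of_thetaLine hli hG' hw' hs
      (hT _ (thetaLine_of_squareOnLine hli hF' hw hs h))) with
    ⟨h1, h2, h3, h4, h5, h6, h7, h8⟩ | ⟨h1, h2, h3, h4, h5⟩
  · refine ⟨coordCoeff e₁ e₂ e₃ 2 2 0 G / coordCoeff e₁ e₂ e₃ 2 2 0 F, div_ne_zero hw' hw, ?_⟩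
    apply eq_of_forall_eval_eq hli
    intro x y z
    rw [smul_eval, hF', hG', h1, h2, h3, h4, h5, h6, h7, h8, binodalForm, binodalForm,
      ← mul_assoc, div_mul_cancel₀ _ hw]
  · rw [h1, h2, h3, h4, h5] at hG'
    exact absurd hirr (not_irreducible_of_eval_eq_binodalForm hli hG')

lemma isSingularAt_of_forall {p : P2} (h : ∀ (v : Fin 3 → ℂ) (hv : v ≠ 0),
    Projectivization.mk ℂ v hv = p → eval v F = 0 ∧ ∀ i, eval v (pderiv i F) = 0) :
    IsSingularAt F p := by
  intro l hl v hv hp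
  match l with
  | [] => exact (h v hv hp).1
  | [i] => exact (h v hv hp).2 i
  | _ :: _ :: _ => simp at hl

lemma exists_isSingularAt_genericity_ne_zero (hli : LinearIndependent ℂ ![e₁, e₂, e₃])
    {p₁ p₂ : P2} (h₁ : e₁ ≠ 0) (h₂ : e₂ ≠ 0) (hp₁ : Projectivization.mk ℂ e₁ h₁ = p₁)
    (hp₂ : Projectivization.mk ℂ e₂ h₂ = p₂) :
    ∃ F : MvPolynomial (Fin 3) ℂ, F.IsHomogeneous 4 ∧ IsSingularAt F p₁ ∧ IsSingularAt F p₂ ∧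
      coordCoeff e₁ e₂ e₃ 2 2 0 F ≠ 0 ∧ genericity (quarticParams e₁ e₂ e₃ F) ≠ 0 := by
  obtain ⟨ξ, η, ζ, hξ, hη, hζ, hξ', hη', hζ'⟩ := exists_coordForms hli
  set F : MvPolynomial (Fin 3) ℂ :=
    ξ ^ 2 * η ^ 2 + C 2 * (ξ ^ 2 * ζ ^ 2) + C (-2) * (η ^ 2 * ζ ^ 2) + C 2 * (ξ * ζ ^ 3) with hF
  have hhom : F.IsHomogeneous 4 :=
    ((((hξ.pow 2).mul (hη.pow 2)).add (((hξ.pow 2).mul (hζ.pow 2)).C_mul 2)).add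
      (((hη.pow 2).mul (hζ.pow 2)).C_mul (-2))).add ((hξ.mul (hζ.pow 3)).C_mul 2)
  have hs₁ : IsSingularAt F p₁ := by
    apply isSingularAt_of_forall
    intro v hv hvp
    obtain ⟨c, rfl⟩ := exists_eq_of_mk_eq (hvp.trans hp₁.symm)
    have h1 := hη' c 0 0
    have h2 := hζ' c 0 0
    simp only [zero_smul, add_zero] at h1 h2
    simp [hF, Derivation.leibniz, Derivation.leibniz_pow, h1, h2]
  have hs₂ : IsSingularAt F p₂ := by
    apply isSingularAt_of_forall
    intro v hv hvp
    obtain ⟨c, rfl⟩ := exists_eq_of_mk_eq (hvp.trans hp₂.symm)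
    have h1 := hξ' 0 c 0
    have h2 := hζ' 0 c 0
    simp only [zero_smul, add_zero, zero_add] at h1 h2
    simp [hF, Derivation.leibniz, Derivation.leibniz_pow, h1, h2]
  have hb := isBinodal_of_isSingularAt (e₃ := e₃) hhom h₁ h₂ hp₁ hp₂ hs₁ hs₂
  have hev : ∀ x y z : ℂ, eval (x • e₁ + y • e₂ + z • e₃) F =
      x ^ 2 * y ^ 2 + 2 * x ^ 2 * z ^ 2 - 2 * y ^ 2 * z ^ 2 + 2 * x * z ^ 3 := by
    intro x y z
    simp only [hF, map_add, map_mul, map_pow, eval_C, hξ', hη', hζ']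
    ring
  have h : ∀ x y z, _ = _ := fun x y z => (hb x y z).symm.trans (hev x y z)
  refine ⟨F, hhom, hs₁, hs₂, ?_⟩
  have hv := h 1 1 0
  have hv1 := h 1 0 1
  have hv2 := h (-1) 0 1
  have hv3 := h 0 0 1
  have hv4 := h 0 1 1
  have hv5 := h 0 (-1) 1
  have hv6 := h 1 1 1
  have hv7 := h 1 (-1) 1
  have hv8 := h (-1) 1 1
  norm_num at hv hv1 hv2 hv3 hv4 hv5 hv6 hv7 hv8
  have c7 : nodalCoeff e₁ e₂ e₃ 7 F = 0 := hv3
  have c2 : nodalCoeff e₁ e₂ e₃ 2 F = 2 := by linear_combination (hv1 + hv2) / 2 - c7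
  have c5 : nodalCoeff e₁ e₂ e₃ 5 F = 1 := by linear_combination (hv1 - hv2) / 4
  have c4 : nodalCoeff e₁ e₂ e₃ 4 F = -2 := by linear_combination (hv4 + hv5) / 2 - c7
  have c6 : nodalCoeff e₁ e₂ e₃ 6 F = 0 := by linear_combination (hv4 - hv5) / 4
  have c1 : nodalCoeff e₁ e₂ e₃ 1 F = 0 := by
    linear_combination (hv6 + hv7) / 4 - hv / 2 - c2 / 2 - c4 / 2 - c5 - c7 / 2
  have c0 : nodalCoeff e₁ e₂ e₃ 0 F = 0 := by
    linear_combination (hv6 + hv8) / 4 - hv / 2 - c2 / 2 - c4 / 2 - c6 - c7 / 2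
  have c3 : nodalCoeff e₁ e₂ e₃ 3 F = 0 := by
    linear_combination (hv6 - hv7) / 4 - c0 - c6
  rw [genericity_ne_zero_iff]
  simp only [quarticParams, centredParams, hv, c0, c1, c2, c3, c4, c5, c6, c7, Matrix.cons_val]
  norm_num
  rw [Polynomial.Separable]
  refine ⟨Polynomial.C (-1 / 16), Polynomial.C (1 / 128) * Polynomial.X, ?_⟩
  apply Polynomial.funext
  intro t
  norm_num [thetaOctic]
  ring

end NormalForm

lemma exists_linearIndependent_rep {p₁ p₂ : P2} (hne : p₁ ≠ p₂) :
    ∃ e₃ : Fin 3 → ℂ, LinearIndependent ℂ ![p₁.rep, p₂.rep, e₃] := by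
  have e : ![p₁.rep, p₂.rep] = Projectivization.rep ∘ ![p₁, p₂] := by
    ext i
    fin_cases i <;> rfl
  have h : LinearIndependent ℂ ![p₁.rep, p₂.rep] := e ▸ Projectivization.independent_iff.mp
    ((Projectivization.independent_pair_iff_ne p₁ p₂).mpr hne)
  obtain ⟨e₃, h3⟩ := exists_linearIndependent_snoc_of_lt_finrank h (by simp)
  have h : ![p₁.rep, p₂.rep, e₃] = Fin.snoc ![p₁.rep, p₂.rep] e₃ := by
    ext i
    fin_cases i <;> rfl
  exact ⟨e₃, h ▸ h3⟩

/-- Fix two distinct points `p₁, p₂ ∈ ℙ²` and let `W` be the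
projective space of quartics singular at both.  The set of irreducible quartics whose
only singularities are ordinary nodes at `p₁` and `p₂` and which fail to be determined,
among such quartics, by their theta-lines, is contained in a proper Zariski-closed
subset of `W` (here: the zero locus of a homogeneous polynomial `P` in the coefficients,
not vanishing identically on quartic forms singular at `p₁` and `p₂`). -/
theorem general_binodal_quartic_theta_property (p₁ p₂ : P2) (hne : p₁ ≠ p₂) :
    ∃ (P : MvPolynomial ((Fin 3) →₀ ℕ) ℂ) (k : ℕ), P.IsHomogeneous k ∧
      (∃ F₀ : MvPolynomial (Fin 3) ℂ, F₀ ≠ 0 ∧ F₀.IsHomogeneous 4 ∧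
        IsSingularAt F₀ p₁ ∧ IsSingularAt F₀ p₂ ∧ eval (fun m => coeff m F₀) P ≠ 0) ∧
      ∀ F : MvPolynomial (Fin 3) ℂ,
        F.IsHomogeneous 4 → Irreducible F →
        OrdinaryNode F p₁ → OrdinaryNode F p₂ →
        (∀ q : P2, IsSingularAt F q → q = p₁ ∨ q = p₂) →
        eval (fun m => coeff m F) P ≠ 0 →
        ∀ G : MvPolynomial (Fin 3) ℂ,
          G.IsHomogeneous 4 → Irreducible G →
          OrdinaryNode G p₁ → OrdinaryNode G p₂ →
          (∀ q : P2, IsSingularAt G q → q = p₁ ∨ q = p₂) →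
          {S : Set P2 | ThetaLine G S} = {S : Set P2 | ThetaLine F S} →
          ∃ c : ℂ, c ≠ 0 ∧ G = c • F := by
  obtain ⟨e₃, hli⟩ := exists_linearIndependent_rep hne
  have hb : ∀ F : MvPolynomial (Fin 3) ℂ, F.IsHomogeneous 4 → IsSingularAt F p₁ →
      IsSingularAt F p₂ → IsBinodal p₁.rep p₂.rep e₃ F := fun F hF h₁ h₂ =>
    isBinodal_of_isSingularAt hF p₁.rep_nonzero p₂.rep_nonzero p₁.mk_rep p₂.mk_rep h₁ h₂
  obtain ⟨P, n, hP, hP'⟩ := exists_homogenization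
    (genericity (centredParams (X : Fin 8 → MvPolynomial (Fin 8) ℂ)))
    (linearForm (coordCoeff p₁.rep p₂.rep e₃ 2 2 0))
    (fun i => linearForm (nodalCoeff p₁.rep p₂.rep e₃ i))
    (isHomogeneous_linearForm _) fun i => isHomogeneous_linearForm _
  have hP4 : ∀ F : MvPolynomial (Fin 3) ℂ, F.IsHomogeneous 4 →
      (eval (fun m => coeff m F) P ≠ 0 ↔ coordCoeff p₁.rep p₂.rep e₃ 2 2 0 F ≠ 0 ∧
        genericity (quarticParams p₁.rep p₂.rep e₃ F) ≠ 0) := by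
    intro F hF
    rw [hP' fun m => coeff m F]
    simp only [eval_linearForm _ hF, map_genericity, map_centredParams, eval_X]
    rfl
  refine ⟨P, n, hP, ?_, ?_⟩
  · obtain ⟨F, hF, h₁, h₂, hw, hgen⟩ := exists_isSingularAt_genericity_ne_zero hli
      p₁.rep_nonzero p₂.rep_nonzero p₁.mk_rep p₂.mk_rep
    refine ⟨F, ?_, hF, h₁, h₂, (hP4 F hF).mpr ⟨hw, hgen⟩⟩
    rintro rfl
    exact hw (map_zero _)
  · intro F hF _ hn₁ hn₂ _ hPF G hG hirr hm₁ hm₂ _ hT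
    obtain ⟨hw, hgen⟩ := (hP4 F hF).mp hPF
    exact (hb F hF hn₁.1.1 hn₂.1.1).exists_eq_smul hli (hb G hG hm₁.1.1 hm₂.1.1) hw hgen hirr
      fun S hS => hT.symm.subset hS

end
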